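/- Let (Ω, 𝔽, μ) be a probability space, let π₁, π₂ : ℝ → Ω → ℝ and C₁, C₂ : ℝ → Ω → ℝ be such that: (i) for every ω ∈ Ω and q ∈ ℝ, the map q ↦ C₁(q, ω) has derivative π₁(q, ω) at q and the map q ↦ C₂(q, ω) has derivative −π₂(q, ω) at q; (ii) for every q, the functions ω ↦ C₁(q, ω), ω ↦ C₂(q, ω), ω ↦ π₁(q, ω), ω ↦ π₂(q, ω) are integrable; (iii) the expected cost J(q) = ∫ (C₁(q, ω) + C₂(q, ω)) dμ(ω) has derivative ∫ π₁(q, ω) dμ(ω) − ∫ π₂(q, ω) dμ(ω) at every q; and (iv) the maps q ↦ ∫ π₁(q, ω) dμ(ω) and q ↦ ∫ π₂(q, ω) dμ(ω) are continuous. Define s(q) = ∫₀^q ( ∫ π₂(x, ω) dμ(ω) − ∫ π₁(x, ω) dμ(ω) ) dx. Then for every Q ∈ ℝ and every q* ≤ Q, q* minimizes J over {q : q ≤ Q} if and only if q* maximizes s over {q : q ≤ Q}. (Theorem 1: the stochastic tie-optimization problem (P5), which maximizes expected social welfare using the expected supply and demand curves, has the same optimizer as the two-stage stochastic cost-minimization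 problem (P4).) -/

import Mathlib

open MeasureTheory

/-- Theorem 1 (stochastic tie optimization): the two-stage stochastic cost
minimization (P4) and the expected-social-welfare maximization (P5) have the
same optimizers over `{q | q ≤ Q}`. -/
theorem stmt_1 {Ω : Type*} [MeasurableSpace Ω] (μ : Measure Ω) [IsProbabilityMeasure μ]
    (π₁ π₂ C₁ C₂ : ℝ → Ω → ℝ)
    (hC₁ : ∀ ω : Ω, ∀ q : ℝ, HasDerivAt (fun q => C₁ q ω) (π₁ q ω) q)
    (hC₂ : ∀ ω : Ω, ∀ q : ℝ, HasDerivAt (fun q => C₂ q ω) (-(π₂ q ω)) q)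
    (hIntC₁ : ∀ q : ℝ, Integrable (C₁ q) μ)
    (hIntC₂ : ∀ q : ℝ, Integrable (C₂ q) μ)
    (hIntπ₁ : ∀ q : ℝ, Integrable (π₁ q) μ)
    (hIntπ₂ : ∀ q : ℝ, Integrable (π₂ q) μ)
    (J : ℝ → ℝ) (hJdef : ∀ q : ℝ, J q = ∫ ω, (C₁ q ω + C₂ q ω) ∂μ)
    (hJ : ∀ q : ℝ, HasDerivAt J ((∫ ω, π₁ q ω ∂μ) - ∫ ω, π₂ q ω ∂μ) q)
    (hcont₁ : Continuous (fun q : ℝ => ∫ ω, π₁ q ω ∂μ))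
    (hcont₂ : Continuous (fun q : ℝ => ∫ ω, π₂ q ω ∂μ))
    (s : ℝ → ℝ)
    (hs : ∀ q : ℝ, s q = ∫ x in (0:ℝ)..q, ((∫ ω, π₂ x ω ∂μ) - ∫ ω, π₁ x ω ∂μ))
    (Q qstar : ℝ) (hq : qstar ≤ Q) :
    IsMinOn J {q : ℝ | q ≤ Q} qstar ↔ IsMaxOn s {q : ℝ | q ≤ Q} qstar := by
  have key : ∀ q, s q = J 0 - J q := fun q => by
    have h := intervalIntegral.integral_eq_sub_of_hasDerivAt (f := fun x => -J x)
      (a := 0) (b := q) (fun x _ => (hJ x).neg)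
      ((hcont₁.sub hcont₂).neg.intervalIntegrable 0 q)
    simp only [neg_sub] at h
    rw [hs q, h]
    ring
  simp only [isMinOn_iff, isMaxOn_iff, key, sub_le_sub_iff_left]
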